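/- arXiv:1202.1889 — 5 statements merged into one kernel-verified Lean document; each statement's English description precedes it below -/
import Mathlib

section
/- For every positive integer r there exists an r-secure frameproof code of length 2·C(2r−1, r−1) and size 2r+1, i.e., an r-SFPC(2·binom(2r−1, r−1), 2r+1). -/
open Finset

/-- The envelope `F(C)`: all words agreeing with the coalition `C` on every
coordinate on which all members of `C` agree (the undetectable coordinates). -/
def envelope {v : ℕ} (C : Finset (Fin v → Bool)) : Set (Fin v → Bool) :=
  {x | ∀ i : Fin v, (∀ w₁ ∈ C, ∀ w₂ ∈ C, w₁ i = w₂ i) → ∀ w ∈ C, x i = w i}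

/-- `Γ` is an `r`-secure frameproof code of length `v` and size `t`:
a `(v, t)`-code such that the envelopes of any two disjoint (nonempty) coalitions
of size at most `r` are disjoint. -/
def IsSFPC (v t r : ℕ) (Γ : Finset (Fin v → Bool)) : Prop :=
  Γ.card = t ∧
    ∀ C₁ C₂ : Finset (Fin v → Bool), C₁ ⊆ Γ → C₂ ⊆ Γ →
      C₁.Nonempty → C₂.Nonempty → C₁.card ≤ r → C₂.card ≤ r → Disjoint C₁ C₂ →
      envelope C₁ ∩ envelope C₂ = ∅

/-- Two disjoint sets of at most `r` points out of `2 * r + 1`, the first of which avoids a given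
point `x`, are separated by an `r`-set avoiding `x`. -/
theorem exists_separating_subset {r : ℕ} (x : Fin (2 * r + 1)) {P Q : Finset (Fin (2 * r + 1))}
    (hP : P.card ≤ r) (hQ : Q.card ≤ r) (hPQ : Disjoint P Q) (hx : x ∉ P) :
    ∃ A ∈ powersetCard r (univ.erase x), P ⊆ A ∧ Disjoint A Q := by
  have hsub : P ⊆ univ.erase x \ Q := by
    intro i hi
    have hiQ : i ∉ Q := Finset.disjoint_left.mp hPQ hi
    have hix : i ≠ x := fun h => hx (h ▸ hi)
    simp [hiQ, hix]
  have hcard : r ≤ (univ.erase x \ Q).card := by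
    have h := Finset.le_card_sdiff Q (univ.erase x)
    rw [Finset.card_erase_of_mem (mem_univ x), Finset.card_univ, Fintype.card_fin] at h
    omega
  obtain ⟨A, hPA, hA, hAr⟩ := Finset.exists_subsuperset_card_eq hsub hP hcard
  obtain ⟨hAx, hAQ⟩ := Finset.subset_sdiff.mp hA
  exact ⟨A, mem_powersetCard.mpr ⟨hAx, hAr⟩, hPA, hAQ⟩

/-- Coalitions that are constant with different values on some coordinate have disjoint
envelopes. -/
theorem envelope_inter_eq_empty {v : ℕ} {C₁ C₂ : Finset (Fin v → Bool)} (h₁ : C₁.Nonempty)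
    (h₂ : C₂.Nonempty) {k : Fin v} {b : Bool} (hb₁ : ∀ w ∈ C₁, w k = b)
    (hb₂ : ∀ w ∈ C₂, w k = !b) : envelope C₁ ∩ envelope C₂ = ∅ := by
  refine Set.eq_empty_iff_forall_notMem.mpr fun x ⟨hx₁, hx₂⟩ => ?_
  obtain ⟨w₁, hw₁⟩ := h₁
  obtain ⟨w₂, hw₂⟩ := h₂
  have e₁ := hx₁ k (fun a ha c hc => (hb₁ a ha).trans (hb₁ c hc).symm) w₁ hw₁
  have e₂ := hx₂ k (fun a ha c hc => (hb₂ a ha).trans (hb₂ c hc).symm) w₂ hw₂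
  rw [e₁, hb₁ w₁ hw₁, hb₂ w₂ hw₂] at e₂
  simp at e₂

/-- A family of words in which any two disjoint sets of at most `r` indices are separated by a
coordinate is an `r`-secure frameproof code. -/
theorem isSFPC_image_of_separating {v t r : ℕ} (hr : 0 < r) (f : Fin t → Fin v → Bool)
    (hf : ∀ P Q : Finset (Fin t), P.card ≤ r → Q.card ≤ r → Disjoint P Q →
      ∃ k b, (∀ i ∈ P, f i k = b) ∧ ∀ i ∈ Q, f i k = !b) :
    IsSFPC v t r (univ.image f) := by
  have hinj : Function.Injective f := by
    intro i j hij
    by_contra hne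
    obtain ⟨k, b, hi, hj⟩ := hf {i} {j} (by simpa using Nat.succ_le_of_lt hr)
      (by simpa using Nat.succ_le_of_lt hr) (by simpa using hne)
    have h₁ := hi i (by simp)
    have h₂ := hj j (by simp)
    rw [← hij, h₁] at h₂
    simp at h₂
  refine ⟨by simp [Finset.card_image_of_injective _ hinj], ?_⟩
  intro C₁ C₂ hC₁ hC₂ hn₁ hn₂ hr₁ hr₂ hdisj
  obtain ⟨P, -, rfl⟩ := Finset.subset_image_iff.mp hC₁
  obtain ⟨Q, -, rfl⟩ := Finset.subset_image_iff.mp hC₂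
  rw [Finset.card_image_of_injective _ hinj] at hr₁ hr₂
  obtain ⟨k, b, hP, hQ⟩ := hf P Q hr₁ hr₂ ((Finset.disjoint_image hinj).mp hdisj)
  exact envelope_inter_eq_empty hn₁ hn₂ (k := k) (b := b) (by simpa using hP) (by simpa using hQ)

theorem choose_two_mul_self {r : ℕ} (hr : 0 < r) :
    (2 * r).choose r = 2 * (2 * r - 1).choose (r - 1) := by
  obtain ⟨s, rfl⟩ := Nat.exists_eq_add_one.mpr hr
  rw [show 2 * (s + 1) = 2 * s + 1 + 1 by ring, Nat.choose_succ_succ, Nat.choose_symm_half]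
  simp [two_mul]

/-- For every positive integer `r` there exists an
`r`-SFPC(2·C(2r−1, r−1), 2r+1). -/
theorem exists_sfpc (r : ℕ) (hr : 0 < r) :
    ∃ Γ : Finset (Fin (2 * Nat.choose (2 * r - 1) (r - 1)) → Bool),
      IsSFPC (2 * Nat.choose (2 * r - 1) (r - 1)) (2 * r + 1) r Γ := by
  have hcard : (powersetCard r (univ.erase (Fin.last (2 * r)))).card =
      2 * Nat.choose (2 * r - 1) (r - 1) := by
    simp [choose_two_mul_self hr]
  let e := Finset.equivFinOfCardEq hcard
  refine ⟨_, isSFPC_image_of_separating hr (fun i k => decide (i ∈ (e.symm k).1)) ?_⟩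
  intro P Q hP hQ hPQ
  by_cases hx : Fin.last (2 * r) ∈ P
  · obtain ⟨A, hA, hQA, hAP⟩ := exists_separating_subset (Fin.last (2 * r)) hQ hP hPQ.symm
      (Finset.disjoint_left.mp hPQ hx)
    refine ⟨e ⟨A, hA⟩, false, fun i hi => ?_, fun i hi => ?_⟩
    · simpa using Finset.disjoint_right.mp hAP hi
    · simpa using hQA hi
  · obtain ⟨A, hA, hPA, hAQ⟩ := exists_separating_subset (Fin.last (2 * r)) hP hQ hPQ hx
    refine ⟨e ⟨A, hA⟩, true, fun i hi => ?_, fun i hi => ?_⟩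
    · simpa using hPA hi
    · simpa using Finset.disjoint_right.mp hAQ hi
end

section
/- If a finite simple graph G contains no 4-cycle C₄ as a subgraph, then the biclique covering number of G equals its vertex covering number: bc(G) = β(G). -/
open Finset

/-- `(X, Y)` spans a biclique (complete bipartite subgraph, possibly edgeless) of `G`. -/
def IsBiclique {V : Type*} (G : SimpleGraph V) (X Y : Set V) : Prop :=
  ∀ x ∈ X, ∀ y ∈ Y, G.Adj x y

/-- `F` is a `d`-biclique cover of `G` of size `s`: a collection of `s` bicliques of `G`
such that every edge of `G` lies in at least `d` of them. -/
def IsBicliqueCover {V : Type*} (G : SimpleGraph V) (d s : ℕ)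
    (F : Fin s → Set V × Set V) : Prop :=
  (∀ i, IsBiclique G (F i).1 (F i).2) ∧
    ∀ u v, G.Adj u v →
      d ≤ Nat.card {i : Fin s // u ∈ (F i).1 ∧ v ∈ (F i).2 ∨ v ∈ (F i).1 ∧ u ∈ (F i).2}

/-- The `d`-biclique covering number `bc_d(G)`: the minimum size of a `d`-biclique
cover of `G`. -/
noncomputable def bc {V : Type*} (G : SimpleGraph V) (d : ℕ) : ℕ :=
  sInf {s | ∃ F : Fin s → Set V × Set V, IsBicliqueCover G d s F}

/-- In a graph without 4-cycles, every biclique is a star. -/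
theorem IsBiclique.exists_vertexCover_card_le_one {V : Type*} [Finite V] {G : SimpleGraph V}
    (hC4 : ∀ a b c d : V, a ≠ b → a ≠ c → a ≠ d → b ≠ c → b ≠ d → c ≠ d →
      ¬(G.Adj a b ∧ G.Adj b c ∧ G.Adj c d ∧ G.Adj d a))
    {X Y : Set V} (h : IsBiclique G X Y) :
    ∃ T : Finset V, T.card ≤ 1 ∧ ∀ x ∈ X, ∀ y ∈ Y, x ∈ T ∨ y ∈ T := by
  have card_le {S : Set V} (hS : S.Subsingleton) : S.toFinite.toFinset.card ≤ 1 :=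
    Finset.card_le_one.2 fun a ha b hb => hS (by simpa using ha) (by simpa using hb)
  by_cases hX : X.Subsingleton
  · exact ⟨X.toFinite.toFinset, card_le hX, fun x hx _ _ => .inl (by simpa using hx)⟩
  · obtain ⟨x₁, hx₁, x₂, hx₂, hx⟩ := Set.not_subsingleton_iff.1 hX
    have hY : Y.Subsingleton := by
      intro y₁ hy₁ y₂ hy₂
      by_contra hy
      exact hC4 x₁ y₁ x₂ y₂ (h _ hx₁ _ hy₁).ne hx (h _ hx₁ _ hy₂).ne (h _ hx₂ _ hy₁).ne' hy
        (h _ hx₂ _ hy₂).ne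
        ⟨h _ hx₁ _ hy₁, (h _ hx₂ _ hy₁).symm, h _ hx₂ _ hy₂, (h _ hx₁ _ hy₂).symm⟩
    exact ⟨Y.toFinite.toFinset, card_le hY, fun _ _ y hy => .inr (by simpa using hy)⟩

/-- The stars centred at the vertices of a vertex cover form a biclique cover. -/
theorem exists_isBicliqueCover_of_vertexCover {V : Type*} {G : SimpleGraph V} {K : Finset V}
    (hK : ∀ u v, G.Adj u v → u ∈ K ∨ v ∈ K) :
    ∃ F : Fin K.card → Set V × Set V, IsBicliqueCover G 1 K.card F := by
  refine ⟨fun i => ({(K.equivFin.symm i : V)}, {v | G.Adj (K.equivFin.symm i) v}), ?_, ?_⟩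
  · rintro i x rfl y hy
    exact hy
  · intro u v huv
    rw [Nat.one_le_iff_ne_zero, ← Nat.pos_iff_ne_zero, Nat.card_pos_iff]
    refine ⟨?_, inferInstance⟩
    rcases hK u v huv with hu | hv
    · exact ⟨K.equivFin ⟨u, hu⟩, by simp [huv]⟩
    · exact ⟨K.equivFin ⟨v, hv⟩, by simp [huv.symm]⟩

/-- In a graph without 4-cycles, the centres of the bicliques of a cover form a vertex cover. -/
theorem IsBicliqueCover.exists_vertexCover {V : Type*} [Finite V] {G : SimpleGraph V}
    (hC4 : ∀ a b c d : V, a ≠ b → a ≠ c → a ≠ d → b ≠ c → b ≠ d → c ≠ d →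
      ¬(G.Adj a b ∧ G.Adj b c ∧ G.Adj c d ∧ G.Adj d a))
    {s : ℕ} {F : Fin s → Set V × Set V} (hF : IsBicliqueCover G 1 s F) :
    ∃ K : Finset V, K.card ≤ s ∧ ∀ u v, G.Adj u v → u ∈ K ∨ v ∈ K := by
  classical
  choose T hT hcover using fun i => (hF.1 i).exists_vertexCover_card_le_one hC4
  refine ⟨Finset.univ.biUnion T, ?_, fun u v huv => ?_⟩
  · simpa using Finset.card_biUnion_le_card_mul Finset.univ T 1 fun i _ => hT i
  · obtain ⟨⟨i, hi⟩⟩ := (Nat.card_pos_iff.1 (hF.2 u v huv)).1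
    simp only [Finset.mem_biUnion, Finset.mem_univ, true_and]
    rcases hi with ⟨hu, hv⟩ | ⟨hv, hu⟩
    · exact (hcover i u hu v hv).imp (⟨i, ·⟩) (⟨i, ·⟩)
    · exact (hcover i v hv u hu).symm.imp (⟨i, ·⟩) (⟨i, ·⟩)

/-- If a finite simple graph `G` contains no 4-cycle as a subgraph,
then its biclique covering number equals its vertex covering number `β(G)`. -/
theorem bc_eq_vertexCover_of_c4Free {V : Type*} [Fintype V] (G : SimpleGraph V)
    (hC4 : ∀ a b c d : V, a ≠ b → a ≠ c → a ≠ d → b ≠ c → b ≠ d → c ≠ d →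
      ¬(G.Adj a b ∧ G.Adj b c ∧ G.Adj c d ∧ G.Adj d a)) :
    bc G 1 = sInf {k | ∃ K : Finset V, K.card = k ∧ ∀ u v, G.Adj u v → u ∈ K ∨ v ∈ K} := by
  apply le_antisymm
  · refine le_csInf ⟨_, Finset.univ, rfl, by simp⟩ ?_
    rintro _ ⟨K, rfl, hK⟩
    exact Nat.sInf_le (exists_isBicliqueCover_of_vertexCover hK)
  · refine le_csInf ⟨_, exists_isBicliqueCover_of_vertexCover (K := Finset.univ) (by simp)⟩ ?_
    rintro s ⟨F, hF⟩
    obtain ⟨K, hKs, hK⟩ := hF.exists_vertexCover hC4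
    exact le_trans (Nat.sInf_le ⟨K, rfl, hK⟩) hKs
end

section
/- Let d, r, w, t be positive integers with t ≥ r + w. For any integers i, j with 1 ≤ i < r and 1 ≤ j < w, N((r,w;d), t) ≥ N((r−i, w−j; m), t), where m = N((i, j; d), t−r−w+i+j). -/
open Finset

/-- `B` is an `(r, w; d)`-cover-free family over the `n`-set `Fin n` with `t` blocks:
for all disjoint `I, J ⊆ [t]` with `|I| = r`, `|J| = w`, at least `d` points lie in
every `B i` for `i ∈ I` and in no `B j` for `j ∈ J`. -/
def IsCFF (n t r w d : ℕ) (B : Fin t → Finset (Fin n)) : Prop :=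
  ∀ I J : Finset (Fin t), I.card = r → J.card = w → Disjoint I J →
    d ≤ (Finset.univ.filter fun x : Fin n => (∀ i ∈ I, x ∈ B i) ∧ ∀ j ∈ J, x ∉ B j).card

/-- `N((r, w; d), t)`: the minimum size of the ground set of an `(r, w; d)`-cover-free
family with `t` blocks. -/
noncomputable def cffNum (r w d t : ℕ) : ℕ :=
  sInf {n | ∃ B : Fin t → Finset (Fin n), IsCFF n t r w d B}

/-- A cover-free family on a finite subset of any type transports to `Fin`. -/
theorem exists_isCFF_card {α : Type*} [DecidableEq α] {t r w d : ℕ} (Y : Finset α)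
    (C : Fin t → Finset α)
    (h : ∀ I J : Finset (Fin t), I.card = r → J.card = w → Disjoint I J →
      d ≤ (Y.filter fun x => (∀ i ∈ I, x ∈ C i) ∧ ∀ j ∈ J, x ∉ C j).card) :
    ∃ B : Fin t → Finset (Fin Y.card), IsCFF Y.card t r w d B := by
  refine ⟨fun k => univ.filter fun x => (Y.equivFin.symm x : α) ∈ C k, ?_⟩
  intro I J hI hJ hIJ
  refine (h I J hI hJ hIJ).trans ?_
  refine card_le_card_of_surjOn (fun x => (Y.equivFin.symm x : α)) ?_
  intro y hy
  obtain ⟨hyY, hy⟩ := mem_filter.1 (mem_coe.1 hy)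
  refine ⟨Y.equivFin ⟨y, hyY⟩, ?_, by simp⟩
  simpa using hy

theorem exists_isCFF (r w d t : ℕ) :
    ∃ n, ∃ B : Fin t → Finset (Fin n), IsCFF n t r w d B := by
  refine ⟨_, exists_isCFF_card (univ : Finset (Finset (Fin t) × Fin d))
    (fun k => univ.filter fun x => k ∈ x.1) ?_⟩
  intro I J _ _ hIJ
  calc d = (({I} : Finset (Finset (Fin t))) ×ˢ (univ : Finset (Fin d))).card := by simp
    _ ≤ _ := by
      refine card_le_card fun x hx => ?_
      obtain ⟨hx, -⟩ := mem_product.1 hx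
      rw [mem_singleton] at hx
      simp only [mem_filter, mem_univ, true_and, hx]
      exact ⟨fun _ h => h, fun _ hj hi => disjoint_left.1 hIJ hi hj⟩

theorem exists_isCFF_cffNum (r w d t : ℕ) :
    ∃ B : Fin t → Finset (Fin (cffNum r w d t)), IsCFF (cffNum r w d t) t r w d B :=
  Nat.sInf_mem (exists_isCFF r w d t)

/-- The points separating fixed disjoint `I` and `J` form the ground set of a cover-free family
whose blocks are the traces of the blocks indexed outside `I ∪ J`. -/
theorem IsCFF.reduce {n t a b i j d s : ℕ} {B : Fin t → Finset (Fin n)}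
    (hB : IsCFF n t (a + i) (b + j) d B) (hs : a + b + s = t) :
    IsCFF n t a b (cffNum i j d s) B := by
  intro I J hI hJ hIJ
  have hcard : ((I ∪ J)ᶜ).card = s := by
    rw [card_compl, card_union_of_disjoint hIJ, Fintype.card_fin]
    omega
  let e : Fin s ↪ Fin t := ((I ∪ J)ᶜ.orderEmbOfFin hcard).toEmbedding
  have he : ∀ k, e k ∉ I ∧ e k ∉ J := by
    intro k
    have h : e k ∈ (I ∪ J)ᶜ := (I ∪ J)ᶜ.orderEmbOfFin_mem hcard k
    simpa using h
  refine Nat.sInf_le (exists_isCFF_card _ (fun k => B (e k)) ?_)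
  intro I' J' hI' hJ' hIJ'
  have hII : Disjoint I (I'.map e) := disjoint_left.2 fun x hx hx' => by
    obtain ⟨k, -, rfl⟩ := mem_map.1 hx'
    exact (he k).1 hx
  have hIJ₁ : Disjoint I (J'.map e) := disjoint_left.2 fun x hx hx' => by
    obtain ⟨k, -, rfl⟩ := mem_map.1 hx'
    exact (he k).1 hx
  have hJI : Disjoint J (I'.map e) := disjoint_left.2 fun x hx hx' => by
    obtain ⟨k, -, rfl⟩ := mem_map.1 hx'
    exact (he k).2 hx
  have hJJ : Disjoint J (J'.map e) := disjoint_left.2 fun x hx hx' => by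
    obtain ⟨k, -, rfl⟩ := mem_map.1 hx'
    exact (he k).2 hx
  refine (hB (I ∪ I'.map e) (J ∪ J'.map e) ?_ ?_ ?_).trans (card_le_card fun x hx => ?_)
  · rw [card_union_of_disjoint hII, card_map, hI, hI']
  · rw [card_union_of_disjoint hJJ, card_map, hJ, hJ']
  · simp only [disjoint_union_left, disjoint_union_right]
    exact ⟨⟨hIJ, hJI.symm⟩, hIJ₁, (disjoint_map e).2 hIJ'⟩
  · obtain ⟨-, hx₁, hx₂⟩ := mem_filter.1 hx
    simp only [mem_filter, mem_univ, true_and]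
    exact ⟨⟨fun k hk => hx₁ k (mem_union_left _ hk), fun k hk => hx₂ k (mem_union_left _ hk)⟩,
      fun k hk => hx₁ _ (mem_union_right _ (mem_map_of_mem e hk)),
      fun k hk => hx₂ _ (mem_union_right _ (mem_map_of_mem e hk))⟩

/-- For positive integers `d, r, w, t` with `t ≥ r + w` and
`1 ≤ i < r`, `1 ≤ j < w`, we have `N((r,w;d), t) ≥ N((r−i, w−j; m), t)` where
`m = N((i, j; d), t−r−w+i+j)`. -/
theorem cffNum_ge (d r w t i j : ℕ) (hd : 0 < d) (hi : 1 ≤ i) (hir : i < r)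
    (hj : 1 ≤ j) (hjw : j < w) (htrw : r + w ≤ t) :
    cffNum (r - i) (w - j) (cffNum i j d (t - r - w + i + j)) t ≤ cffNum r w d t := by
  obtain ⟨B, hB⟩ := exists_isCFF_cffNum r w d t
  refine Nat.sInf_le ⟨B, IsCFF.reduce (i := i) (j := j) ?_ (by omega)⟩
  rwa [Nat.sub_add_cancel hir.le, Nat.sub_add_cancel hjw.le]
end

section
/- Let d be a positive integer such that a Hadamard matrix of order 4d exists. Then bc_{2d}(K_{8d}) = 4d, where K_{8d} is the complete graph on 8d vertices. -/
open Finset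

/-- `H` is a Hadamard matrix of order `n`: a `±1` matrix with `H * Hᵀ = n • I`. -/
def IsHadamard (n : ℕ) (H : Matrix (Fin n) (Fin n) ℝ) : Prop :=
  (∀ i j, H i j = 1 ∨ H i j = -1) ∧ H * H.transpose = (n : ℝ) • 1

lemma natCard_subtype_eq_sum_ite {ι : Type*} [Fintype ι] (P : ι → Prop) [DecidablePred P] :
    (Nat.card {i // P i} : ℝ) = ∑ i, if P i then (1 : ℝ) else 0 := by
  rw [Nat.card_eq_fintype_card, Fintype.card_subtype, Finset.card_filter]
  push_cast
  rfl

open Classical in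
/-- A biclique of a graph on `n` vertices covers at most `n ^ 2 / 2` ordered pairs. -/
lemma IsBiclique.sum_covered_le {V : Type*} [Fintype V] {G : SimpleGraph V} {X Y : Set V}
    (h : IsBiclique G X Y) :
    ∑ u, ∑ v, (if u ∈ X ∧ v ∈ Y ∨ v ∈ X ∧ u ∈ Y then (1 : ℝ) else 0) ≤
      (Fintype.card V : ℝ) ^ 2 / 2 := by
  have disjoint : ∀ u ∈ X, u ∉ Y := fun u hX hY => G.loopless.irrefl u (h u hX u hY)
  let ε : V → ℝ := fun u => if u ∈ X then 1 else -1
  have pointwise : ∀ u v, (if u ∈ X ∧ v ∈ Y ∨ v ∈ X ∧ u ∈ Y then (1 : ℝ) else 0) ≤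
      (1 - ε u * ε v) / 2 := by
    intro u v
    have hu := disjoint u
    have hv := disjoint v
    by_cases h1 : u ∈ X <;> by_cases h2 : v ∈ X <;> simp [ε, h1, h2] <;>
      split_ifs <;> simp_all
  calc _ ≤ ∑ u, ∑ v, (1 - ε u * ε v) / 2 :=
        Finset.sum_le_sum fun u _ => Finset.sum_le_sum fun v _ => pointwise u v
    _ = ((Fintype.card V : ℝ) ^ 2 - (∑ u, ε u) ^ 2) / 2 := by
        simp only [← Finset.sum_div, Finset.sum_sub_distrib, ← Finset.mul_sum, ← Finset.sum_mul]
        simp [sq]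
    _ ≤ _ := by nlinarith [sq_nonneg (∑ u, ε u)]

/-- Double counting bound for biclique covers of complete graphs. -/
lemma IsBicliqueCover.card_bound {V : Type*} [Fintype V] {d s : ℕ}
    {F : Fin s → Set V × Set V} (hF : IsBicliqueCover (⊤ : SimpleGraph V) d s F) :
    (Fintype.card V : ℝ) * (Fintype.card V - 1) * d ≤ s * ((Fintype.card V : ℝ) ^ 2 / 2) := by
  classical
  obtain ⟨hB, hC⟩ := hF
  calc (Fintype.card V : ℝ) * (Fintype.card V - 1) * d
      = ∑ u : V, ∑ v : V, ((d : ℝ) - if u = v then (d : ℝ) else 0) := by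
        simp only [Finset.sum_sub_distrib, Finset.sum_ite_eq, Finset.mem_univ, if_true]
        simp
        ring
    _ ≤ ∑ u : V, ∑ v : V, ∑ i : Fin s,
          if u ∈ (F i).1 ∧ v ∈ (F i).2 ∨ v ∈ (F i).1 ∧ u ∈ (F i).2 then (1 : ℝ) else 0 := by
        refine Finset.sum_le_sum fun u _ => Finset.sum_le_sum fun v _ => ?_
        split_ifs with huv
        · rw [sub_self]
          exact Finset.sum_nonneg fun i _ => by split_ifs <;> norm_num
        · have := hC u v huv
          rw [← natCard_subtype_eq_sum_ite, sub_zero]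
          exact_mod_cast this
    _ = ∑ i : Fin s, ∑ u : V, ∑ v : V,
          if u ∈ (F i).1 ∧ v ∈ (F i).2 ∨ v ∈ (F i).1 ∧ u ∈ (F i).2 then (1 : ℝ) else 0 := by
        rw [Finset.sum_comm]
        simp_rw [Finset.sum_comm (s := (Finset.univ : Finset V)) (t := (Finset.univ : Finset (Fin s)))]
        exact Finset.sum_congr rfl fun i _ => Finset.sum_comm
    _ ≤ ∑ _i : Fin s, (Fintype.card V : ℝ) ^ 2 / 2 :=
        Finset.sum_le_sum fun i _ => (hB i).sum_covered_le
    _ = _ := by simp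

/-- The columns of a `±1` matrix whose distinct rows have nonpositive inner products
give a biclique cover of the complete graph on its rows. -/
lemma isBicliqueCover_of_sign_matrix {V : Type*} {d s : ℕ} (hs : 2 * d ≤ s)
    (A : V → Fin s → ℝ) (hA : ∀ u j, A u j = 1 ∨ A u j = -1)
    (horth : ∀ u v, u ≠ v → ∑ j, A u j * A v j ≤ 0) :
    IsBicliqueCover (⊤ : SimpleGraph V) d s
      (fun j => ({u | A u j = 1}, {u | A u j = -1})) := by
  classical
  constructor
  · rintro j x hx y hy rfl
    simp only [Set.mem_ofPred_eq] at hx hy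
    linarith
  · intro u v huv
    have key : (d : ℝ) ≤ ∑ j : Fin s,
        if A u j = 1 ∧ A v j = -1 ∨ A v j = 1 ∧ A u j = -1 then (1 : ℝ) else 0 := by
      have hterm : ∀ j, (if A u j = 1 ∧ A v j = -1 ∨ A v j = 1 ∧ A u j = -1 then (1 : ℝ) else 0)
          = (1 - A u j * A v j) / 2 := by
        intro j
        rcases hA u j with h1 | h1 <;> rcases hA v j with h2 | h2 <;> rw [h1, h2] <;> norm_num
      simp only [hterm, ← Finset.sum_div, Finset.sum_sub_distrib]
      have := horth u v huv
      have hs' : (2 : ℝ) * d ≤ s := by exact_mod_cast hs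
      simp
      linarith
    rw [← natCard_subtype_eq_sum_ite] at key
    exact_mod_cast key

/-- The rows of a Hadamard matrix and their negatives form a `±1` matrix whose distinct rows have
nonpositive inner products. -/
lemma IsHadamard.exists_sign_matrix {n : ℕ} {H : Matrix (Fin n) (Fin n) ℝ}
    (hH : IsHadamard n H) :
    ∃ A : Fin (2 * n) → Fin n → ℝ, (∀ u j, A u j = 1 ∨ A u j = -1) ∧
      ∀ u v, u ≠ v → ∑ j, A u j * A v j ≤ 0 := by
  obtain ⟨hpm, hmul⟩ := hH
  have hrows : ∀ i k, ∑ j, H i j * H k j = if i = k then (n : ℝ) else 0 := by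
    intro i k
    have := congrFun (congrFun hmul i) k
    simpa [Matrix.mul_apply, Matrix.one_apply] using this
  let e : Fin (2 * n) ≃ Fin 2 × Fin n := finProdFinEquiv.symm
  let σ : Fin 2 → ℝ := fun b => if b = 0 then 1 else -1
  refine ⟨fun u j => σ (e u).1 * H (e u).2 j, fun u j => ?_, fun u v huv => ?_⟩
  · rcases hpm (e u).2 j with h | h <;> by_cases hb : (e u).1 = 0 <;> simp [σ, h, hb]
  · have hne : e u ≠ e v := e.injective.ne huv
    have hfactor : ∑ j, σ (e u).1 * H (e u).2 j * (σ (e v).1 * H (e v).2 j) =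
        σ (e u).1 * σ (e v).1 * ∑ j, H (e u).2 j * H (e v).2 j := by
      rw [Finset.mul_sum]
      exact Finset.sum_congr rfl fun j _ => by ring
    rw [hfactor, hrows]
    generalize e u = p at hne ⊢
    generalize e v = q at hne ⊢
    obtain ⟨a, i⟩ := p
    obtain ⟨b, k⟩ := q
    by_cases hik : i = k
    · subst hik
      fin_cases a <;> fin_cases b <;> simp_all [σ]
    · simp [hik]

/-- If a Hadamard matrix of order `4d` exists (`d > 0`), then the
`2d`-biclique covering number of the complete graph `K_{8d}` equals `4d`. -/
theorem bc_complete_of_hadamard (d : ℕ) (hd : 0 < d)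
    (H : Matrix (Fin (4 * d)) (Fin (4 * d)) ℝ) (hH : IsHadamard (4 * d) H) :
    bc (⊤ : SimpleGraph (Fin (8 * d))) (2 * d) = 4 * d := by
  have hcover : 4 * d ∈ {s | ∃ F : Fin s → Set (Fin (8 * d)) × Set (Fin (8 * d)),
      IsBicliqueCover ⊤ (2 * d) s F} := by
    obtain ⟨A, hA, horth⟩ := hH.exists_sign_matrix
    have hd8 : 2 * (4 * d) = 8 * d := by ring
    generalize 2 * (4 * d) = m at A hA horth hd8
    subst hd8
    exact ⟨_, isBicliqueCover_of_sign_matrix (by omega) A hA horth⟩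
  refine le_antisymm (Nat.sInf_le hcover) (le_csInf ⟨_, hcover⟩ ?_)
  rintro s ⟨F, hF⟩
  have hbound := hF.card_bound
  simp only [Fintype.card_fin] at hbound
  push_cast at hbound
  have hdpos : (0 : ℝ) < d := by exact_mod_cast hd
  have hs : (8 * d - 1 : ℝ) ≤ 2 * s := by
    refine le_of_mul_le_mul_left ?_ (show (0 : ℝ) < 16 * d ^ 2 by positivity)
    linarith
  have hs' : 8 * d ≤ 2 * s + 1 := by
    have : (8 * d : ℝ) ≤ 2 * s + 1 := by linarith
    exact_mod_cast this
  omega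
end

section
/- Let d be a positive integer such that a Hadamard matrix of order 4d exists. Then N((1,1;d), 8d−2) = 4d; that is, the minimum n for which a (1,1;d)-cover-free family over an n-set with 8d−2 blocks exists equals 4d. -/
open Finset

/-- Being a `(1, 1; d)`-cover-free family only concerns the pairwise differences of blocks. -/
lemma isCFF_one_one_iff {n t d : ℕ} {B : Fin t → Finset (Fin n)} :
    IsCFF n t 1 1 d B ↔ ∀ i j, i ≠ j → d ≤ (B i \ B j).card := by
  have key (i j : Fin t) :
      (Finset.univ.filter fun x : Fin n => x ∈ B i ∧ x ∉ B j) = B i \ B j := by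
    ext x
    simp
  constructor
  · intro h i j hij
    simpa [key] using h {i} {j} (by simp) (by simp) (by simpa using hij)
  · intro h I J hI hJ hIJ
    obtain ⟨i, rfl⟩ := Finset.card_eq_one.mp hI
    obtain ⟨j, rfl⟩ := Finset.card_eq_one.mp hJ
    simpa [key] using h i j (by simpa using hIJ)

/-- Double counting the triples `(i, j, x)` with `x ∈ B i \ B j`. -/
lemma IsCFF.four_mul_le {n t d : ℕ} {B : Fin t → Finset (Fin n)} (hB : IsCFF n t 1 1 d B) :
    4 * ((d : ℤ) * (t * (t - 1))) ≤ n * t ^ 2 := by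
  rw [isCFF_one_one_iff] at hB
  let b : Fin t → Fin n → ℤ := fun i x => if x ∈ B i then 1 else 0
  have hcard (i j : Fin t) : ((B i \ B j).card : ℤ) = ∑ x, b i x * (1 - b j x) := by
    have : ((B i \ B j).card : ℤ) = ∑ x, if x ∈ B i \ B j then 1 else 0 := by
      rw [Finset.sum_boole, Finset.filter_univ_mem]
    rw [this]
    refine Finset.sum_congr rfl fun x _ => ?_
    by_cases hi : x ∈ B i <;> by_cases hj : x ∈ B j <;> simp [b, hi, hj]
  have hlow : (d : ℤ) * (t * (t - 1)) ≤ ∑ i, ∑ j, ∑ x, b i x * (1 - b j x) := by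
    calc (d : ℤ) * (t * (t - 1)) = ∑ i : Fin t, ∑ j : Fin t, ((d : ℤ) - if i = j then d else 0) := by
          simp [Finset.sum_sub_distrib]
          ring
      _ ≤ _ := by
          refine Finset.sum_le_sum fun i _ => Finset.sum_le_sum fun j _ => ?_
          rw [← hcard]
          split_ifs with h
          · simp
          · simpa using hB i j h
  have hswap : ∑ i, ∑ j, ∑ x, b i x * (1 - b j x) = ∑ x, (∑ i, b i x) * (t - ∑ j, b j x) := by
    have hx (x : Fin n) : (∑ i, b i x) * (t - ∑ j, b j x) = ∑ i, ∑ j, b i x * (1 - b j x) := by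
      rw [← Finset.sum_mul_sum]
      simp
    simp_rw [hx]
    rw [Finset.sum_comm (γ := Fin n)]
    exact Finset.sum_congr rfl fun i _ => Finset.sum_comm
  have hup : 4 * ∑ x, (∑ i, b i x) * (t - ∑ j, b j x) ≤ n * t ^ 2 := by
    rw [Finset.mul_sum]
    calc _ ≤ ∑ _x : Fin n, (t : ℤ) ^ 2 := by
          refine Finset.sum_le_sum fun x _ => ?_
          nlinarith [sq_nonneg ((t : ℤ) - 2 * ∑ i, b i x)]
      _ = _ := by simp
  linarith

/-- Any `±1` vectors with zero sums and pairwise nonpositive inner products give a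
cover-free family. -/
lemma exists_isCFF_of_signs {d t : ℕ} (f : Fin t → Fin (4 * d) → ℝ)
    (hf : ∀ i x, f i x = 1 ∨ f i x = -1) (hsum : ∀ i, ∑ x, f i x = 0)
    (hinner : ∀ i j, i ≠ j → ∑ x, f i x * f j x ≤ 0) :
    ∃ B : Fin t → Finset (Fin (4 * d)), IsCFF (4 * d) t 1 1 d B := by
  classical
  refine ⟨fun i => Finset.univ.filter fun x => f i x = 1, isCFF_one_one_iff.mpr fun i j hij => ?_⟩
  set S := (Finset.univ.filter fun x => f i x = 1) \ Finset.univ.filter fun x => f j x = 1 with hS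
  have hcard : 4 * (S.card : ℝ) = ∑ x, (1 + f i x) * (1 - f j x) := by
    have : (S.card : ℝ) = ∑ x, if x ∈ S then 1 else 0 := by simp
    rw [this, Finset.mul_sum]
    refine Finset.sum_congr rfl fun x _ => ?_
    rcases hf i x with h | h <;> rcases hf j x with h' | h' <;> norm_num [hS, h, h']
  have hexp : ∑ x, (1 + f i x) * (1 - f j x) = 4 * d - ∑ x, f i x * f j x := by
    have (x : Fin (4 * d)) :
        (1 + f i x) * (1 - f j x) = 1 + f i x - f j x - f i x * f j x := by ring
    simp [this, Finset.sum_sub_distrib, Finset.sum_add_distrib, hsum]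
  have := hinner i j hij
  have : (d : ℝ) ≤ S.card := by linarith
  exact_mod_cast this

lemma IsHadamard.sum_mul {n : ℕ} {H : Matrix (Fin n) (Fin n) ℝ} (hH : IsHadamard n H)
    (i j : Fin n) : ∑ x, H i x * H j x = if i = j then (n : ℝ) else 0 := by
  have h := congrFun (congrFun hH.2 i) j
  simpa [Matrix.mul_apply, Matrix.one_apply] using h

/-- The rows of a normalized Hadamard matrix other than the first, together with their
negatives, give a cover-free family. -/
lemma IsHadamard.exists_isCFF {d : ℕ} (hd : 0 < d) {H : Matrix (Fin (4 * d)) (Fin (4 * d)) ℝ}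
    (hH : IsHadamard (4 * d) H) :
    ∃ B : Fin (8 * d - 2) → Finset (Fin (4 * d)), IsCFF (4 * d) (8 * d - 2) 1 1 d B := by
  let z : Fin (4 * d) := ⟨0, by omega⟩
  let r : Fin (8 * d - 2) → Fin (4 * d) := fun k => ⟨k / 2 + 1, by omega⟩
  let s : Fin (8 * d - 2) → ℝ := fun k => if (k : ℕ) % 2 = 0 then 1 else -1
  have hz (x) : H z x * H z x = 1 := by rcases hH.1 z x with h | h <;> simp [h]
  refine exists_isCFF_of_signs (fun k x => s k * (H z x * H (r k) x)) ?_ ?_ ?_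
  · intro k x
    rcases hH.1 z x with h | h <;> rcases hH.1 (r k) x with h' | h' <;>
      by_cases hk : (k : ℕ) % 2 = 0 <;> simp [s, h, h', hk]
  · intro k
    have hne : z ≠ r k := by simp [z, r, Fin.ext_iff]
    rw [← Finset.mul_sum, hH.sum_mul, if_neg hne, mul_zero]
  · intro k l hkl
    have hterm (x) : s k * (H z x * H (r k) x) * (s l * (H z x * H (r l) x)) =
        s k * s l * (H (r k) x * H (r l) x) := by
      linear_combination s k * s l * (H (r k) x * H (r l) x) * hz x
    simp_rw [hterm]
    rw [← Finset.mul_sum, hH.sum_mul]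
    split_ifs with h
    · have hdiv : (k : ℕ) / 2 = l / 2 := by simpa [r] using h
      have hkl' : (k : ℕ) ≠ l := fun e => hkl (Fin.ext e)
      have hs : s k * s l = -1 := by
        by_cases hk : (k : ℕ) % 2 = 0
        · have hl : (l : ℕ) % 2 ≠ 0 := by omega
          simp only [s, if_pos hk, if_neg hl, one_mul]
        · have hl : (l : ℕ) % 2 = 0 := by omega
          simp only [s, if_neg hk, if_pos hl, mul_one]
      rw [hs, neg_one_mul, neg_nonpos]
      positivity
    · simp

/-- If a Hadamard matrix of order `4d` exists (`d > 0`), then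
`N((1,1;d), 8d−2) = 4d`. -/
theorem cffNum_of_hadamard (d : ℕ) (hd : 0 < d)
    (H : Matrix (Fin (4 * d)) (Fin (4 * d)) ℝ) (hH : IsHadamard (4 * d) H) :
    cffNum 1 1 d (8 * d - 2) = 4 * d := by
  have hmem := hH.exists_isCFF hd
  refine le_antisymm (Nat.sInf_le hmem) (le_csInf ⟨_, hmem⟩ ?_)
  rintro n ⟨B, hB⟩
  have h := hB.four_mul_le
  have ht : ((8 * d - 2 : ℕ) : ℤ) = 2 * (4 * d - 1) := by omega
  rw [ht] at h
  by_contra! hn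
  have hn' : (n : ℤ) ≤ 4 * d - 1 := by omega
  have hd' : (1 : ℤ) ≤ d := by omega
  have hle : (n : ℤ) * (2 * (4 * d - 1)) ^ 2 ≤ (4 * d - 1) * (2 * (4 * d - 1)) ^ 2 :=
    mul_le_mul_of_nonneg_right hn' (sq_nonneg _)
  have hfac : (4 * (d : ℤ) - 1) * (2 * d - 1) ≤ 0 := by nlinarith
  nlinarith
end
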